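/- Let T > 0, let a, b ≥ 0, let δ ∈ (0,1), and let f : [0,T] → ℝ be a nonnegative Lebesgue-integrable function such that f(t) ≤ a + (b/δ) · ∫₀ᵗ f(τ)^{1−δ} dτ for almost every t ∈ [0,T]. Then f(t) ≤ (a^δ + b·t)^{1/δ} for almost every t ∈ [0,T]. -/

import Mathlib

open MeasureTheory

lemma sublinear_gronwall_aux (T A b δ : ℝ) (hA : 0 < A) (hb : 0 ≤ b)
    (hδ0 : 0 < δ) (hδ1 : δ < 1) (f g : ℝ → ℝ) (hg : Integrable g)
    (hg0 : ∀ t, 0 ≤ g t) (hfg : ∀ t ∈ Set.Icc 0 T, g t = f t ^ (1 - δ))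
    (hf_nonneg : ∀ t ∈ Set.Icc 0 T, 0 ≤ f t)
    (h : ∀ᵐ t : ℝ, t ∈ Set.Icc 0 T → f t ≤ A + (b / δ) * ∫ τ in (0:ℝ)..t, g τ) :
    ∀ t ∈ Set.Icc 0 T, A + (b / δ) * (∫ τ in (0:ℝ)..t, g τ) ≤ (A ^ δ + b * t) ^ (1 / δ) := by
  have hbd : 0 ≤ b / δ := by positivity
  set F : ℝ → ℝ := fun t => A + (b / δ) * ∫ τ in (0:ℝ)..t, g τ with hF
  have hFc : Continuous F := by
    have := intervalIntegral.continuous_primitive (μ := volume) (f := g)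
      (fun a b => hg.intervalIntegrable) 0
    exact continuous_const.add (continuous_const.mul this)
  have hFA : ∀ t, 0 ≤ t → A ≤ F t := by
    intro t ht
    have : 0 ≤ ∫ τ in (0:ℝ)..t, g τ := intervalIntegral.integral_nonneg ht (fun u _ => hg0 u)
    have := mul_nonneg hbd this
    simp only [hF]; linarith
  have hPc : Continuous (fun t => F t ^ (1 - δ)) :=
    hFc.rpow_const (fun x => Or.inr (by linarith))
  set H : ℝ → ℝ := fun t => A + (b / δ) * ∫ τ in (0:ℝ)..t, F τ ^ (1 - δ) with hH
  have hHd : ∀ t, HasDerivAt H ((b / δ) * F t ^ (1 - δ)) t := by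
    intro t
    have := (hPc.integral_hasStrictDerivAt 0 t).hasDerivAt
    exact (this.const_mul (b / δ)).const_add A
  have hFH : ∀ t ∈ Set.Icc 0 T, F t ≤ H t := by
    intro t ht
    have : ∫ τ in (0:ℝ)..t, g τ ≤ ∫ τ in (0:ℝ)..t, F τ ^ (1 - δ) := by
      apply intervalIntegral.integral_mono_ae_restrict ht.1 hg.intervalIntegrable
        (hPc.intervalIntegrable _ _)
      refine (ae_restrict_iff' measurableSet_Icc).2 ?_
      filter_upwards [h] with s hs hst
      have hsT : s ∈ Set.Icc 0 T := ⟨hst.1, hst.2.trans ht.2⟩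
      change g s ≤ F s ^ (1 - δ)
      rw [hfg s hsT]
      exact Real.rpow_le_rpow (hf_nonneg s hsT) (hs hsT) (by linarith)
    have := mul_le_mul_of_nonneg_left this hbd
    simp only [hF, hH] at *; linarith
  have hHpos : ∀ t ∈ Set.Icc 0 T, 0 < H t := fun t ht =>
    hA.trans_le ((hFA t ht.1).trans (hFH t ht))
  have hKd : ∀ t ∈ Set.Icc 0 T, HasDerivAt (fun t => H t ^ δ - b * t)
      ((b / δ) * F t ^ (1 - δ) * δ * H t ^ (δ - 1) - b * 1) t := by
    intro t ht
    exact ((hHd t).rpow_const (Or.inl (hHpos t ht).ne')).sub ((hasDerivAt_id t).const_mul b)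
  have hanti : AntitoneOn (fun t => H t ^ δ - b * t) (Set.Icc 0 T) := by
    apply antitoneOn_of_deriv_nonpos (convex_Icc 0 T)
    · intro t ht
      exact (hKd t ht).continuousAt.continuousWithinAt
    · intro t ht
      exact (hKd t (interior_subset ht)).differentiableAt.differentiableWithinAt
    · intro t ht
      have ht := interior_subset ht
      rw [(hKd t ht).deriv]
      have h1 : F t ^ (1 - δ) ≤ H t ^ (1 - δ) :=
        Real.rpow_le_rpow (hA.le.trans (hFA t ht.1)) (hFH t ht) (by linarith)
      have h2 : H t ^ (1 - δ) * H t ^ (δ - 1) = 1 := by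
        rw [← Real.rpow_add (hHpos t ht)]; simp
      have h3 : F t ^ (1 - δ) * H t ^ (δ - 1) ≤ 1 := by
        exact (mul_le_mul_of_nonneg_right h1 (Real.rpow_nonneg (hHpos t ht).le _)).trans h2.le
      have h4 : (b / δ) * F t ^ (1 - δ) * δ * H t ^ (δ - 1)
          = b * (F t ^ (1 - δ) * H t ^ (δ - 1)) := by
        field_simp
      rw [h4]
      nlinarith
  intro t ht
  have h0 : (0:ℝ) ∈ Set.Icc 0 T := ⟨le_rfl, ht.1.trans ht.2⟩
  have h5 := hanti h0 ht ht.1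
  have h6 : H 0 = A := by simp [hH]
  simp only [h6] at h5
  have h7 : H t ^ δ ≤ A ^ δ + b * t := by linarith
  have h8 : (H t ^ δ) ^ (1 / δ) = H t := by
    rw [← Real.rpow_mul (hHpos t ht).le, mul_one_div_cancel hδ0.ne', Real.rpow_one]
  calc F t ≤ H t := hFH t ht
    _ = (H t ^ δ) ^ (1 / δ) := h8.symm
    _ ≤ _ := Real.rpow_le_rpow (Real.rpow_nonneg (hHpos t ht).le _) h7 (by positivity)

/-- Gronwall-type lemma for a sublinear integral inequality (Yudovich's argument):
if `f : [0,T] → ℝ` is nonnegative and integrable, `a, b ≥ 0`, `δ ∈ (0,1)`, and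
`f(t) ≤ a + (b/δ)·∫₀ᵗ f(τ)^(1−δ) dτ` for a.e. `t ∈ [0,T]`, then
`f(t) ≤ (a^δ + b·t)^(1/δ)` for a.e. `t ∈ [0,T]`. -/
theorem sublinear_gronwall (T a b δ : ℝ) (hT : 0 < T) (ha : 0 ≤ a) (hb : 0 ≤ b)
    (hδ : δ ∈ Set.Ioo (0 : ℝ) 1) (f : ℝ → ℝ)
    (hf_int : IntegrableOn f (Set.Icc 0 T))
    (hf_nonneg : ∀ t ∈ Set.Icc 0 T, 0 ≤ f t)
    (hf_ineq : ∀ᵐ t : ℝ, t ∈ Set.Icc 0 T →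
      f t ≤ a + (b / δ) * ∫ τ in (0:ℝ)..t, f τ ^ (1 - δ)) :
    ∀ᵐ t : ℝ, t ∈ Set.Icc 0 T → f t ≤ (a ^ δ + b * t) ^ (1 / δ) := by
  obtain ⟨hδ0, hδ1⟩ := hδ
  set g : ℝ → ℝ := (Set.Icc 0 T).indicator (fun t => f t ^ (1 - δ)) with hgdef
  have hfg : ∀ t ∈ Set.Icc 0 T, g t = f t ^ (1 - δ) := fun t ht => Set.indicator_of_mem ht _
  have hg0 : ∀ t, 0 ≤ g t := fun t =>
    Set.indicator_nonneg (fun s hs => Real.rpow_nonneg (hf_nonneg s hs) _) t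
  have hg : Integrable g := by
    rw [hgdef, integrable_indicator_iff measurableSet_Icc]
    have h1 : IntegrableOn (fun t => 1 + f t) (Set.Icc 0 T) :=
      (integrableOn_const (by simp)).add hf_int
    refine Integrable.mono' h1
      (hf_int.aestronglyMeasurable.aemeasurable.pow_const _).aestronglyMeasurable ?_
    refine (ae_restrict_iff' measurableSet_Icc).2 (Filter.Eventually.of_forall ?_)
    intro t ht
    have h0 := hf_nonneg t ht
    rw [Real.norm_of_nonneg (Real.rpow_nonneg h0 _)]
    calc f t ^ (1 - δ) ≤ (1 + f t) ^ (1 - δ) :=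
          Real.rpow_le_rpow h0 (by linarith) (by linarith)
      _ ≤ (1 + f t) ^ (1 : ℝ) :=
          Real.rpow_le_rpow_of_exponent_le (by linarith) (by linarith)
      _ = 1 + f t := Real.rpow_one _
  have hineq : ∀ᵐ t : ℝ, t ∈ Set.Icc 0 T → f t ≤ a + (b / δ) * ∫ τ in (0:ℝ)..t, g τ := by
    filter_upwards [hf_ineq] with t h ht
    have : ∫ τ in (0:ℝ)..t, g τ = ∫ τ in (0:ℝ)..t, f τ ^ (1 - δ) := by
      apply intervalIntegral.integral_congr
      intro s hs
      rw [Set.uIcc_of_le ht.1] at hs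
      exact hfg s ⟨hs.1, hs.2.trans ht.2⟩
    rw [this]
    exact h ht
  have key : ∀ ε > 0, ∀ t ∈ Set.Icc 0 T,
      a + ε + (b / δ) * (∫ τ in (0:ℝ)..t, g τ) ≤ ((a + ε) ^ δ + b * t) ^ (1 / δ) := by
    intro ε hε
    apply sublinear_gronwall_aux T (a + ε) b δ (by linarith) hb hδ0 hδ1 f g hg hg0 hfg hf_nonneg
    filter_upwards [hineq] with t h ht
    linarith [h ht]
  filter_upwards [hineq] with t h ht
  have hc : Continuous (fun ε : ℝ => ((a + ε) ^ δ + b * t) ^ (1 / δ)) := by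
    refine Continuous.rpow_const ?_ (fun x => Or.inr (by positivity))
    refine Continuous.add ?_ continuous_const
    exact Continuous.rpow_const (by fun_prop) (fun x => Or.inr hδ0.le)
  have hlim := (hc.tendsto 0).mono_left (nhdsWithin_le_nhds (s := Set.Ioi 0))
  simp only [add_zero] at hlim
  refine ge_of_tendsto hlim ?_
  filter_upwards [self_mem_nhdsWithin] with ε hε
  have hε' : (0:ℝ) < ε := hε
  linarith [h ht, key ε hε' t ht]
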